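/- arXiv:2409.05291 — 3 statements merged into one kernel-verified Lean document; each statement's English description precedes it below -/
import Mathlib

section
/- Let d ≥ 1, N ≥ 1, H ≥ 1, let L > 0 and η > 0 satisfy 3ηLH ≤ 1, let f_i : EuclideanSpace ℝ (Fin d) → ℝ for i = 1,…,N be differentiable functions whose gradients are L-Lipschitz (‖∇f_i(x) − ∇f_i(y)‖ ≤ L‖x − y‖ for all x, y), and set f = (1/N)∑_{i=1}^N f_i. Fix θ̄ and define the exact-gradient Fast-FedPG local iterates of agent i by θ_{i,0} = θ̄ and θ_{i,ℓ+1} = θ_{i,ℓ} − η(∇f_i(θ_{i,ℓ}) − ∇f_i(θ̄) + ∇f(θ̄)). Then for every i ∈ {1,…,N} and every ℓ ∈ {0,…,H}, ‖θ_{i,ℓ} − θ̄‖² ≤ 32 η² H² ‖∇f(θ̄)‖². -/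
/-- A perturbed gradient iteration with constant drift `v` and an `L`-Lipschitz correction `G`
moves away from its starting point at most linearly in the number of steps, as long as
`3 * η * L * H ≤ 1`. -/
theorem norm_drift_le_of_lipschitz_correction {E : Type*} [NormedAddCommGroup E] [NormedSpace ℝ E]
    {L η : ℝ} (hη : 0 ≤ η) (hL : 0 ≤ L) {H : ℕ} (hstep : 3 * η * L * H ≤ 1)
    {G : E → E} {x₀ v : E} (hG : ∀ x, ‖G x - G x₀‖ ≤ L * ‖x - x₀‖)
    {x : ℕ → E} (hx0 : x 0 = x₀) (hx : ∀ n, x (n + 1) = x n - η • (G (x n) - G x₀ + v)) :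
    ∀ n ≤ H, ‖x n - x₀‖ ≤ 2 * η * n * ‖v‖ := by
  intro n
  induction n with
  | zero => simp [hx0]
  | succ n ih =>
    intro hn
    have ihn := ih (by lia)
    have hstep_n : 3 * η * L * n ≤ 1 := by
      refine le_trans ?_ hstep
      gcongr
      lia
    have hηv : 0 ≤ η * ‖v‖ := by positivity
    calc ‖x (n + 1) - x₀‖ = ‖(x n - x₀) - η • (G (x n) - G x₀ + v)‖ := by
          rw [hx, sub_right_comm]
      _ ≤ ‖x n - x₀‖ + ‖η • (G (x n) - G x₀ + v)‖ := norm_sub_le _ _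
      _ = ‖x n - x₀‖ + η * ‖G (x n) - G x₀ + v‖ := by
          rw [norm_smul, Real.norm_of_nonneg hη]
      _ ≤ ‖x n - x₀‖ + η * (L * ‖x n - x₀‖ + ‖v‖) := by
          gcongr
          exact (norm_add_le _ _).trans (by gcongr; exact hG _)
      _ ≤ 2 * η * n * ‖v‖ + η * (L * (2 * η * n * ‖v‖) + ‖v‖) := by gcongr
      _ ≤ 2 * η * (n + 1 : ℕ) * ‖v‖ := by
          push_cast
          linarith [mul_le_mul_of_nonneg_right hstep_n hηv]

theorem stmt_7 {d N H : ℕ} (hd : 1 ≤ d) (hN : 1 ≤ N) (hH : 1 ≤ H)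
    (L η : ℝ) (hL : 0 < L) (hη : 0 < η) (hstep : 3 * η * L * H ≤ 1)
    (f : Fin N → EuclideanSpace ℝ (Fin d) → ℝ)
    (hdiff : ∀ i, Differentiable ℝ (f i))
    (hlip : ∀ i x y, ‖gradient (f i) x - gradient (f i) y‖ ≤ L * ‖x - y‖)
    (favg : EuclideanSpace ℝ (Fin d) → ℝ)
    (hfavg : ∀ x, favg x = (1 / (N : ℝ)) * ∑ i, f i x)
    (θbar : EuclideanSpace ℝ (Fin d))
    (θ : Fin N → ℕ → EuclideanSpace ℝ (Fin d))
    (hθ0 : ∀ i, θ i 0 = θbar)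
    (hθ : ∀ i ℓ, θ i (ℓ + 1) =
      θ i ℓ - η • (gradient (f i) (θ i ℓ) - gradient (f i) θbar + gradient favg θbar)) :
    ∀ i, ∀ ℓ ≤ H, ‖θ i ℓ - θbar‖ ^ 2 ≤
      32 * η ^ 2 * H ^ 2 * ‖gradient favg θbar‖ ^ 2 := by
  intro i ℓ hℓ
  have hdrift := norm_drift_le_of_lipschitz_correction hη.le hL.le hstep
    (fun x => hlip i x θbar) (hθ0 i) (hθ i) ℓ hℓ
  calc ‖θ i ℓ - θbar‖ ^ 2 ≤ (2 * η * H * ‖gradient favg θbar‖) ^ 2 := by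
        gcongr
        refine hdrift.trans ?_
        gcongr
    _ = 4 * η ^ 2 * H ^ 2 * ‖gradient favg θbar‖ ^ 2 := by ring
    _ ≤ 32 * η ^ 2 * H ^ 2 * ‖gradient favg θbar‖ ^ 2 := by
        gcongr
        norm_num
end

section
/- Let d ≥ 1, N ≥ 1, H ≥ 1, let L > 0 and η > 0 satisfy ηLH ≤ 1/100, let f_i : EuclideanSpace ℝ (Fin d) → ℝ for i = 1,…,N be differentiable functions whose gradients are L-Lipschitz (‖∇f_i(x) − ∇f_i(y)‖ ≤ L‖x − y‖ for all x, y), and set f = (1/N)∑_{i=1}^N f_i. Fix θ̄, define the local iterates of agent i by θ_{i,0} = θ̄ and θ_{i,ℓ+1} = θ_{i,ℓ} − η(∇f_i(θ_{i,ℓ}) − ∇f_i(θ̄) + ∇f(θ̄)) for ℓ = 0,…,H−1, and the server update θ̄⁺ = θ̄ + (1/N)∑_{i=1}^N (θ_{i,H} − θ̄). Then f(θ̄⁺) ≤ f(θ̄) − (ηH/4)‖∇f(θ̄)‖². -/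
/-- First-order expansion of a function with Lipschitz gradient (without the sharp factor `1 / 2`
in front of the quadratic term). -/
theorem le_add_inner_gradient_add_mul_norm_sq {F : Type*} [NormedAddCommGroup F]
    [InnerProductSpace ℝ F] [CompleteSpace F] {f : F → ℝ} {L : ℝ} (hL : 0 ≤ L)
    (hf : Differentiable ℝ f)
    (hlip : ∀ x y, ‖gradient f x - gradient f y‖ ≤ L * ‖x - y‖) (x y : F) :
    f y ≤ f x + inner ℝ (gradient f x) (y - x) + L * ‖y - x‖ ^ 2 := by
  have hbound : ∀ z ∈ segment ℝ x y,
      ‖InnerProductSpace.toDual ℝ F (gradient f z) - InnerProductSpace.toDual ℝ F (gradient f x)‖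
        ≤ L * ‖y - x‖ := by
    intro z hz
    rw [← map_sub, LinearIsometryEquiv.norm_map]
    exact (hlip z x).trans (by gcongr; simpa using norm_sub_le_of_mem_segment hz)
  have key := Convex.norm_image_sub_le_of_norm_hasFDerivWithin_le'
    (fun z _ => (hf z).hasGradientAt.hasFDerivAt.hasFDerivWithinAt) hbound
    (convex_segment x y) (left_mem_segment ℝ x y) (right_mem_segment ℝ x y)
  rw [InnerProductSpace.toDual_apply_apply] at key
  have := (abs_le.mp key).2
  linarith [this, sq ‖y - x‖, mul_assoc L ‖y - x‖ ‖y - x‖]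

theorem gradient_const_mul_sum {F ι : Type*} [NormedAddCommGroup F] [InnerProductSpace ℝ F]
    [CompleteSpace F] (s : Finset ι) (c : ℝ) {f : ι → F → ℝ} {x : F}
    (hf : ∀ i ∈ s, DifferentiableAt ℝ (f i) x) :
    gradient (fun y => c * ∑ i ∈ s, f i y) x = c • ∑ i ∈ s, gradient (f i) x := by
  refine HasGradientAt.gradient ?_
  rw [hasGradientAt_iff_hasFDerivAt, map_smul, map_sum]
  exact (HasFDerivAt.fun_sum fun i hi => (hf i hi).hasGradientAt.hasFDerivAt).const_mul c

/-- Drift-corrected local gradient steps stay close to gradient descent steps with the fixed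
direction `g`. -/
theorem norm_drift_corrected_iterate_le {F : Type*} [NormedAddCommGroup F] [NormedSpace ℝ F]
    {L η : ℝ} (hL : 0 ≤ L) (hη : 0 ≤ η) {G : F → F} (hG : ∀ x y, ‖G x - G y‖ ≤ L * ‖x - y‖)
    (g x₀ : F) {θ : ℕ → F} (hθ0 : θ 0 = x₀)
    (hθ : ∀ n, θ (n + 1) = θ n - η • (G (θ n) - G x₀ + g)) {n : ℕ}
    (hn : η * L * n ≤ 1 / 100) :
    ‖θ n - x₀ + (η * n) • g‖ ≤ η * n * ‖g‖ / 10 := by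
  induction n with
  | zero => simp [hθ0]
  | succ n ih =>
    push_cast at hn ⊢
    have hηL : 0 ≤ η * L := mul_nonneg hη hL
    have hn' : η * L * n ≤ 1 / 100 := by linarith
    have ih := ih hn'
    have hdist : ‖θ n - x₀‖ ≤ η * n * ‖g‖ * (11 / 10) := by
      have h := norm_sub_le (θ n - x₀ + (η * n) • g) ((η * n) • g)
      rw [add_sub_cancel_right, norm_smul, Real.norm_of_nonneg (by positivity)] at h
      linarith
    have hstep : θ (n + 1) - x₀ + (η * (n + 1)) • g
        = (θ n - x₀ + (η * n) • g) - η • (G (θ n) - G x₀) := by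
      rw [hθ]
      module
    have hcorr : ‖η • (G (θ n) - G x₀)‖ ≤ η * ‖g‖ / 10 := by
      rw [norm_smul, Real.norm_of_nonneg hη]
      calc η * ‖G (θ n) - G x₀‖ ≤ η * (L * (η * n * ‖g‖ * (11 / 10))) := by
            gcongr
            exact (hG _ _).trans (by gcongr)
        _ = η * L * n * (η * ‖g‖ * (11 / 10)) := by ring
        _ ≤ 1 / 100 * (η * ‖g‖ * (11 / 10)) := by gcongr
        _ ≤ η * ‖g‖ / 10 := by nlinarith [mul_nonneg hη (norm_nonneg g)]
    rw [hstep]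
    linarith [norm_sub_le (θ n - x₀ + (η * n) • g) (η • (G (θ n) - G x₀))]


theorem stmt_8 {d N H : ℕ} (hd : 1 ≤ d) (hN : 1 ≤ N) (hH : 1 ≤ H)
    (L η : ℝ) (hL : 0 < L) (hη : 0 < η) (hstep : η * L * H ≤ 1 / 100)
    (f : Fin N → EuclideanSpace ℝ (Fin d) → ℝ)
    (hdiff : ∀ i, Differentiable ℝ (f i))
    (hlip : ∀ i x y, ‖gradient (f i) x - gradient (f i) y‖ ≤ L * ‖x - y‖)
    (favg : EuclideanSpace ℝ (Fin d) → ℝ)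
    (hfavg : ∀ x, favg x = (1 / (N : ℝ)) * ∑ i, f i x)
    (θbar : EuclideanSpace ℝ (Fin d))
    (θ : Fin N → ℕ → EuclideanSpace ℝ (Fin d))
    (hθ0 : ∀ i, θ i 0 = θbar)
    (hθ : ∀ i ℓ, θ i (ℓ + 1) =
      θ i ℓ - η • (gradient (f i) (θ i ℓ) - gradient (f i) θbar + gradient favg θbar))
    (θplus : EuclideanSpace ℝ (Fin d))
    (hθplus : θplus = θbar + (1 / (N : ℝ)) • ∑ i, (θ i H - θbar)) :
    favg θplus ≤ favg θbar - (η * H / 4) * ‖gradient favg θbar‖ ^ 2 := by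
  have hN0 : (N : ℝ) ≠ 0 := by positivity
  set g := gradient favg θbar with hg
  set Δ := θplus - θbar with hΔ
  have hgrad : g = (1 / (N : ℝ)) • ∑ i, gradient (f i) θbar := by
    rw [hg, funext hfavg]
    exact gradient_const_mul_sum _ _ fun i _ => hdiff i θbar
  have hdrift : ‖Δ + (η * H) • g‖ ≤ η * H * ‖g‖ / 10 := by
    have hmean : Δ + (η * H) • g = (1 / (N : ℝ)) • ∑ i, (θ i H - θbar + (η * H) • g) := by
      rw [Finset.sum_add_distrib, smul_add, Finset.sum_const, Finset.card_univ, Fintype.card_fin,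
        ← Nat.cast_smul_eq_nsmul ℝ, smul_smul (1 / (N : ℝ)), one_div_mul_cancel hN0, one_smul,
        hΔ, hθplus, add_sub_cancel_left]
    have hsum : ‖∑ i, (θ i H - θbar + (η * H) • g)‖ ≤ N * (η * H * ‖g‖ / 10) := by
      refine (norm_sum_le_of_le _ fun i _ => norm_drift_corrected_iterate_le hL.le hη.le
        (hlip i) g θbar (hθ0 i) (hθ i) hstep).trans ?_
      simp
    rw [hmean, norm_smul, Real.norm_of_nonneg (by positivity)]
    calc 1 / (N : ℝ) * ‖∑ i, (θ i H - θbar + (η * H) • g)‖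
        ≤ 1 / (N : ℝ) * (N * (η * H * ‖g‖ / 10)) := by gcongr
      _ = η * H * ‖g‖ / 10 := by field_simp
  have hdescent : favg θplus ≤ favg θbar + inner ℝ g Δ + L * ‖Δ‖ ^ 2 := by
    have hsum := Finset.sum_le_sum fun i (_ : i ∈ Finset.univ) =>
      le_add_inner_gradient_add_mul_norm_sq hL.le (hdiff i) (hlip i) θbar θplus
    rw [Finset.sum_add_distrib, Finset.sum_add_distrib, Finset.sum_const, Finset.card_univ,
      Fintype.card_fin, nsmul_eq_mul, ← sum_inner, ← hΔ] at hsum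
    rw [hfavg, hfavg, hgrad, real_inner_smul_left]
    calc 1 / (N : ℝ) * ∑ i, f i θplus ≤ 1 / (N : ℝ) * _ :=
          mul_le_mul_of_nonneg_left hsum (by positivity)
      _ = _ := by field_simp
  have hinner : inner ℝ g Δ ≤ -(9 / 10) * (η * H * ‖g‖ ^ 2) := by
    have h := (real_inner_le_norm g (Δ + (η * H) • g)).trans
      (mul_le_mul_of_nonneg_left hdrift (norm_nonneg g))
    rw [inner_add_right, real_inner_smul_right, real_inner_self_eq_norm_sq] at h
    linarith
  have hnorm : ‖Δ‖ ≤ 11 / 10 * (η * H * ‖g‖) := by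
    have h := norm_sub_le (Δ + (η * H) • g) ((η * H) • g)
    rw [add_sub_cancel_right, norm_smul, Real.norm_of_nonneg (by positivity)] at h
    linarith
  have hquad : L * ‖Δ‖ ^ 2 ≤ 1 / 10 * (η * H * ‖g‖ ^ 2) := by
    calc L * ‖Δ‖ ^ 2 ≤ L * (11 / 10 * (η * H * ‖g‖)) ^ 2 := by gcongr
      _ = η * L * H * (121 / 100 * (η * H * ‖g‖ ^ 2)) := by ring
      _ ≤ 1 / 100 * (121 / 100 * (η * H * ‖g‖ ^ 2)) := by gcongr
      _ ≤ 1 / 10 * (η * H * ‖g‖ ^ 2) := by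
          have : 0 ≤ η * H * ‖g‖ ^ 2 := by positivity
          linarith
  have : 0 ≤ η * H * ‖g‖ ^ 2 := by positivity
  linarith
end

section
/- Let d ≥ 1, N ≥ 1, H ≥ 1, let L > 0 and η > 0 satisfy ηLH ≤ 1/100, let f_i : EuclideanSpace ℝ (Fin d) → ℝ for i = 1,…,N be differentiable functions whose gradients are L-Lipschitz, and set f = (1/N)∑_{i=1}^N f_i. Define the server iterates θ̄ : ℕ → EuclideanSpace ℝ (Fin d) recursively: given θ̄(t), set θ_{i,0} = θ̄(t), θ_{i,ℓ+1} = θ_{i,ℓ} − η(∇f_i(θ_{i,ℓ}) − ∇f_i(θ̄(t)) + ∇f(θ̄(t))) for ℓ = 0,…,H−1, and θ̄(t+1) = θ̄(t) + (1/N)∑_{i=1}^N (θ_{i,H} − θ̄(t)). Then for every T ≥ 1, (1/T)∑_{t=0}^{T−1} ‖∇f(θ̄(t))‖² ≤ 4(f(θ̄(0)) − f(θ̄(T)))/(ηHT). -/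
/-- First-order Taylor bound for a function with Lipschitz gradient. -/
theorem le_add_inner_gradient_add_sq_of_lipschitz_gradient
    {E : Type*} [NormedAddCommGroup E] [InnerProductSpace ℝ E] [CompleteSpace E]
    {g : E → ℝ} {L : ℝ} (hL : 0 ≤ L) (hg : Differentiable ℝ g)
    (hlip : ∀ x y, ‖gradient g x - gradient g y‖ ≤ L * ‖x - y‖) (x y : E) :
    g y ≤ g x + inner ℝ (gradient g x) (y - x) + L * ‖y - x‖ ^ 2 := by
  have hball : ∀ z ∈ Metric.closedBall x ‖y - x‖,
      ‖fderiv ℝ g z - fderiv ℝ g x‖ ≤ L * ‖y - x‖ := fun z hz => by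
    rw [← toDual_gradient, ← toDual_gradient, ← map_sub, LinearIsometryEquiv.norm_map]
    rw [mem_closedBall_iff_norm] at hz
    exact (hlip z x).trans (by gcongr)
  have h := (convex_closedBall x ‖y - x‖).norm_image_sub_le_of_norm_fderiv_le'
    (fun z _ => hg z) hball (Metric.mem_closedBall_self (norm_nonneg _))
    (mem_closedBall_iff_norm.2 le_rfl)
  rw [← inner_gradient_left, Real.norm_eq_abs] at h
  linarith [le_abs_self (g y - g x - inner ℝ (gradient g x) (y - x))]

/-- The gradient of an average of differentiable functions is the average of the gradients. -/
theorem hasGradientAt_average {ι E : Type*} [Fintype ι]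
    [NormedAddCommGroup E] [InnerProductSpace ℝ E] [CompleteSpace E]
    {f : ι → E → ℝ} (hf : ∀ i, Differentiable ℝ (f i)) (c : ℝ) (x : E) :
    HasGradientAt (fun z => c * ∑ i, f i z) (c • ∑ i, gradient (f i) x) x := by
  rw [hasGradientAt_iff_hasFDerivAt, map_smulₛₗ, map_sum]
  exact (HasFDerivAt.fun_sum fun i _ => (hf i x).hasGradientAt.hasFDerivAt).const_mul c

/-- An average of vectors of norm at most `C` has norm at most `C`. -/
theorem norm_average_le {N : ℕ} (hN : 1 ≤ N) {E : Type*} [NormedAddCommGroup E] [NormedSpace ℝ E]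
    {v : Fin N → E} {C : ℝ} (hv : ∀ i, ‖v i‖ ≤ C) : ‖(1 / (N : ℝ)) • ∑ i, v i‖ ≤ C := by
  have hN' : (0 : ℝ) < N := by exact_mod_cast hN
  have h : ‖∑ i, v i‖ ≤ N * C := by
    simpa using norm_sum_le_of_le Finset.univ fun i _ => hv i
  rw [norm_smul, Real.norm_of_nonneg (by positivity), one_div, inv_mul_le_iff₀ hN']
  exact h

/-- Drift-corrected local updates stay close to the gradient step in the direction `v`. -/
theorem norm_local_drift_le {E : Type*} [NormedAddCommGroup E] [NormedSpace ℝ E]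
    {G : E → E} {L η : ℝ} {H : ℕ} (hL : 0 ≤ L) (hη : 0 ≤ η) (hstep : η * L * H ≤ 1 / 100)
    (hG : ∀ x y, ‖G x - G y‖ ≤ L * ‖x - y‖) {u : ℕ → E} {x v : E} (hu0 : u 0 = x)
    (hu : ∀ l, u (l + 1) = u l - η • (G (u l) - G x + v)) {l : ℕ} (hl : l ≤ H) :
    ‖u l - x + (η * l) • v‖ ≤ η * l * ‖v‖ / 50 := by
  induction l with
  | zero => simp [hu0]
  | succ l ih =>
    have ih := ih (by omega)
    have hlH : (l : ℝ) ≤ H := by exact_mod_cast (by omega : l ≤ H)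
    have hdist : ‖u l - x‖ ≤ η * l * ‖v‖ * (51 / 50) := by
      have h := norm_sub_le (u l - x + (η * l) • v) ((η * l) • v)
      rw [add_sub_cancel_right, norm_smul, Real.norm_of_nonneg (by positivity : 0 ≤ η * l)] at h
      linarith
    have heq : u (l + 1) - x + (η * (l + 1 : ℕ)) • v
        = (u l - x + (η * l) • v) - η • (G (u l) - G x) := by
      rw [hu]; push_cast; module
    have hsmall : η * L * l ≤ 1 / 100 := (by gcongr : η * L * l ≤ η * L * H).trans hstep
    have hv : 0 ≤ η * ‖v‖ := by positivity
    calc ‖u (l + 1) - x + (η * (l + 1 : ℕ)) • v‖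
        ≤ ‖u l - x + (η * l) • v‖ + η * ‖G (u l) - G x‖ := by
          rw [heq]
          refine (norm_sub_le _ _).trans_eq ?_
          rw [norm_smul, Real.norm_of_nonneg hη]
      _ ≤ η * l * ‖v‖ / 50 + η * (L * (η * l * ‖v‖ * (51 / 50))) := by
          gcongr
          exact (hG _ _).trans (by gcongr)
      _ = η * l * ‖v‖ / 50 + (η * L * l) * (η * ‖v‖) * (51 / 50) := by ring
      _ ≤ η * l * ‖v‖ / 50 + (1 / 100) * (η * ‖v‖) * (51 / 50) := by gcongr
      _ ≤ η * (l + 1 : ℕ) * ‖v‖ / 50 := by push_cast; linarith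

/-- A step close to an exact gradient step of size `α` decreases the objective. -/
theorem descent_of_approx_gradient_step
    {E : Type*} [NormedAddCommGroup E] [InnerProductSpace ℝ E] [CompleteSpace E]
    {g : E → ℝ} {L α : ℝ} (hL : 0 ≤ L) (hα : 0 ≤ α) (hstep : α * L ≤ 1 / 100)
    (hg : Differentiable ℝ g)
    (hlip : ∀ x y, ‖gradient g x - gradient g y‖ ≤ L * ‖x - y‖) {x y : E}
    (hxy : ‖y - x + α • gradient g x‖ ≤ α * ‖gradient g x‖ / 50) :
    α * ‖gradient g x‖ ^ 2 ≤ 4 * (g x - g y) := by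
  have htaylor := le_add_inner_gradient_add_sq_of_lipschitz_gradient hL hg hlip x y
  set v := gradient g x
  have hdist : ‖y - x‖ ≤ α * ‖v‖ * (51 / 50) := by
    have h := norm_sub_le (y - x + α • v) (α • v)
    rw [add_sub_cancel_right, norm_smul, Real.norm_of_nonneg hα] at h
    linarith
  have hinner : inner ℝ v (y - x) ≤ α * ‖v‖ ^ 2 / 50 - α * ‖v‖ ^ 2 := by
    have h1 := real_inner_le_norm v (y - x + α • v)
    rw [inner_add_right, real_inner_smul_right, real_inner_self_eq_norm_sq] at h1
    have h2 := mul_le_mul_of_nonneg_left hxy (norm_nonneg v)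
    linarith
  have hquad : L * ‖y - x‖ ^ 2 ≤ α * ‖v‖ ^ 2 / 50 := by
    have hnn : 0 ≤ α * ‖v‖ ^ 2 := by positivity
    calc L * ‖y - x‖ ^ 2 ≤ L * (α * ‖v‖ * (51 / 50)) ^ 2 := by gcongr
      _ = (α * L) * (α * ‖v‖ ^ 2) * (51 / 50) ^ 2 := by ring
      _ ≤ (1 / 100) * (α * ‖v‖ ^ 2) * (51 / 50) ^ 2 := by gcongr
      _ ≤ α * ‖v‖ ^ 2 / 50 := by linarith
  have hnn : 0 ≤ α * ‖v‖ ^ 2 := by positivity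
  linarith

theorem stmt_10 {d N H : ℕ} (hd : 1 ≤ d) (hN : 1 ≤ N) (hH : 1 ≤ H)
    (L η : ℝ) (hL : 0 < L) (hη : 0 < η) (hstep : η * L * H ≤ 1 / 100)
    (f : Fin N → EuclideanSpace ℝ (Fin d) → ℝ)
    (hdiff : ∀ i, Differentiable ℝ (f i))
    (hlip : ∀ i x y, ‖gradient (f i) x - gradient (f i) y‖ ≤ L * ‖x - y‖)
    (favg : EuclideanSpace ℝ (Fin d) → ℝ)
    (hfavg : ∀ x, favg x = (1 / (N : ℝ)) * ∑ i, f i x)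
    (θbar : ℕ → EuclideanSpace ℝ (Fin d))
    (θ : ℕ → Fin N → ℕ → EuclideanSpace ℝ (Fin d))
    (hθ0 : ∀ t i, θ t i 0 = θbar t)
    (hθ : ∀ t i ℓ, θ t i (ℓ + 1) = θ t i ℓ -
      η • (gradient (f i) (θ t i ℓ) - gradient (f i) (θbar t) + gradient favg (θbar t)))
    (hserv : ∀ t, θbar (t + 1) = θbar t + (1 / (N : ℝ)) • ∑ i, (θ t i H - θbar t)) :
    ∀ T : ℕ, 1 ≤ T →
      (1 / (T : ℝ)) * ∑ t ∈ Finset.range T, ‖gradient favg (θbar t)‖ ^ 2 ≤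
        4 * (favg (θbar 0) - favg (θbar T)) / (η * H * T) := by
  have hN' : (0 : ℝ) < N := by exact_mod_cast hN
  have hH' : (0 : ℝ) < H := by exact_mod_cast hH
  have hgrad : ∀ x, HasGradientAt favg ((1 / (N : ℝ)) • ∑ i, gradient (f i) x) x := fun x => by
    rw [funext hfavg]
    exact hasGradientAt_average hdiff _ x
  have hfavg_lip : ∀ x y, ‖gradient favg x - gradient favg y‖ ≤ L * ‖x - y‖ := fun x y => by
    rw [(hgrad x).gradient, (hgrad y).gradient, ← smul_sub, ← Finset.sum_sub_distrib]
    exact norm_average_le hN fun i => hlip i x y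
  have hdescent : ∀ t, η * H * ‖gradient favg (θbar t)‖ ^ 2
      ≤ 4 * (favg (θbar t) - favg (θbar (t + 1))) := fun t => by
    refine descent_of_approx_gradient_step hL.le (by positivity) (by linarith)
      (fun x => (hgrad x).differentiableAt) hfavg_lip ?_
    have heq : θbar (t + 1) - θbar t + (η * H) • gradient favg (θbar t) =
        (1 / (N : ℝ)) • ∑ i, (θ t i H - θbar t + (η * H) • gradient favg (θbar t)) := by
      rw [hserv, Finset.sum_add_distrib, Finset.sum_const, Finset.card_univ, Fintype.card_fin,
        smul_add, ← Nat.cast_smul_eq_nsmul ℝ, smul_smul (1 / (N : ℝ)), one_div_mul_cancel hN'.ne',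
        one_smul, add_sub_cancel_left]
    rw [heq]
    exact norm_average_le hN fun i =>
      norm_local_drift_le hL.le hη.le hstep (hlip i) (hθ0 t i) (hθ t i) le_rfl
  intro T hT
  have hT' : (0 : ℝ) < T := by exact_mod_cast hT
  have hsum : η * H * ∑ t ∈ Finset.range T, ‖gradient favg (θbar t)‖ ^ 2
      ≤ 4 * (favg (θbar 0) - favg (θbar T)) := by
    rw [← Finset.sum_range_sub' (fun t => favg (θbar t)), Finset.mul_sum, Finset.mul_sum]
    exact Finset.sum_le_sum fun t _ => hdescent t
  rw [le_div_iff₀ (by positivity)]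
  refine le_of_eq_of_le ?_ hsum
  field_simp
end
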